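/- Let A be a strictly full triangulated subcategory of a triangulated category B such that the épaisse envelope of A coincides with B. Then an object X of B belongs to A if and only if its class [X] ∈ K₀(B) lies in the image of the homomorphism K₀(A) → K₀(B). -/

import Mathlib

/- STATEMENT 17: if A is a strictly full triangulated subcategory of a triangulated
category B whose épaisse envelope is all of B, then an object X of B lies in A if
and only if its class [X] ∈ K₀(B) lies in the image of K₀(A) → K₀(B), i.e. in the
subgroup of K₀(B) generated by the classes of the objects of A. -/

open CategoryTheory Limits Pretriangulated Opposite

universe v u

variable {B : Type u} [Category.{v} B] [HasZeroObject B] [Preadditive B]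
  [HasShift B ℤ] [∀ n : ℤ, (shiftFunctor B n).Additive] [Pretriangulated B]

/-- `Y` is a direct sum of `X` and `Z`. -/
def IsDirectSumOf (Y X Z : B) : Prop :=
  ∃ (i : X ⟶ Y) (j : Z ⟶ Y) (p : Y ⟶ X) (q : Y ⟶ Z),
    i ≫ p = 𝟙 X ∧ j ≫ q = 𝟙 Z ∧ i ≫ q = 0 ∧ j ≫ p = 0 ∧ p ≫ i + q ≫ j = 𝟙 Y

/-- `X` is a direct summand of `Y`. -/
def IsSummand (X Y : B) : Prop := ∃ Z : B, IsDirectSumOf Y X Z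

/-- a class of objects is closed under direct summands. -/
def SmdClosed (A : Set B) : Prop := ∀ ⦃X Y : B⦄, IsSummand X Y → Y ∈ A → X ∈ A

/-- `S` is (the class of objects of) a strictly full triangulated subcategory. -/
structure IsTriangulatedSub (S : Set B) : Prop where
  iso : ∀ ⦃X Y : B⦄, (X ≅ Y) → X ∈ S → Y ∈ S
  shift : ∀ (X : B) (n : ℤ), X ∈ S → X⟦n⟧ ∈ S
  cone : ∀ T : Triangle B, T ∈ (distTriang B) → T.obj₁ ∈ S → T.obj₂ ∈ S → T.obj₃ ∈ S

/-- the épaisse (thick) envelope of `S`. -/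
def ThickEnvelope (S : Set B) : Set B :=
  ⋂₀ {T : Set B | S ⊆ T ∧ IsTriangulatedSub T ∧ SmdClosed T}

/-- `F(C)`: the free abelian group on the isomorphism classes of objects of `C`. -/
abbrev FGroup (C : Type*) [Category C] := FreeAbelianGroup (Quotient (isIsomorphicSetoid C))

/-- the generator `[X]` of `F(C)` attached to an object `X`. -/
def fo {C : Type*} [Category C] (X : C) : FGroup C :=
  FreeAbelianGroup.of (Quotient.mk (isIsomorphicSetoid C) X)


/-- the subgroup of relations defining `K₀(B)`: generated by `[Y] − [X] − [Z]` for
every distinguished triangle `X → Y → Z`. -/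
def K0RelB : AddSubgroup (FGroup B) :=
  AddSubgroup.closure
    {x | ∃ T : Triangle B, T ∈ (distTriang B) ∧ x = fo T.obj₂ - fo T.obj₁ - fo T.obj₃}

/-- `K₀(B)`. -/
def K0B := FGroup B ⧸ K0RelB (B := B)

instance : AddCommGroup (K0B (B := B)) :=
  inferInstanceAs (AddCommGroup (FGroup B ⧸ K0RelB (B := B)))

/-- the class of an object of `B` in `K₀(B)`. -/
def clsB (X : B) : K0B (B := B) := QuotientAddGroup.mk (fo X)

/-- The image of the homomorphism `K₀(A) → K₀(B)` induced by the inclusion of the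
full triangulated subcategory `A` on the class of objects `S`: it is the subgroup
of `K₀(B)` generated by the classes of the objects of `A`. -/
def K0AImage (S : Set B) : AddSubgroup (K0B (B := B)) :=
  AddSubgroup.closure {y | ∃ W ∈ S, y = clsB W}

open scoped ZeroObject

/-- A cancellative and cofinal submonoid of a commutative monoid is the kernel of a homomorphism
to a group. -/
theorem AddSubmonoid.exists_addMonoidHom_eq_zero_iff {M : Type u} [AddCommMonoid M]
    (s : AddSubmonoid M) (cancel : ∀ a b, a ∈ s → a + b ∈ s → b ∈ s)
    (cofinal : ∀ a, ∃ b, a + b ∈ s) :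
    ∃ (G : Type u) (_ : AddCommGroup G) (f : M →+ G), ∀ a, f a = 0 ↔ a ∈ s := by
  let c : AddCon M :=
    { r := fun a b => ∃ w, a + w ∈ s ∧ b + w ∈ s
      iseqv :=
        { refl := fun a => (cofinal a).imp fun _ h => ⟨h, h⟩
          symm := fun ⟨w, h, h'⟩ => ⟨w, h', h⟩
          trans := by
            rintro a b d ⟨w, haw, hbw⟩ ⟨v, hbv, hdv⟩
            refine ⟨w + b + v, ?_, ?_⟩
            · convert s.add_mem haw hbv using 1
              abel
            · convert s.add_mem hdv hbw using 1
              abel }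
      add' := by
        rintro a b d e ⟨w, haw, hbw⟩ ⟨v, hdv, hev⟩
        refine ⟨w + v, ?_, ?_⟩
        · convert s.add_mem haw hdv using 1
          abel
        · convert s.add_mem hbw hev using 1
          abel }
  have hc : ∀ a : M, (a : c.Quotient) = 0 ↔ a ∈ s := fun a => by
    refine c.eq.trans ⟨?_, fun ha => ⟨0, by simpa using ha, by simp⟩⟩
    rintro ⟨w, haw, hw⟩
    exact cancel w a (by simpa using hw) (by rwa [add_comm])
  have hneg : ∀ x : c.Quotient, ∃ y, y + x = 0 := fun x => by
    induction x using AddCon.induction_on with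
    | H a =>
      obtain ⟨b, hb⟩ := cofinal a
      exact ⟨b, (hc (b + a)).2 (by rwa [add_comm])⟩
  choose neg hneg using hneg
  let G : AddCommGroup c.Quotient :=
    { (inferInstance : AddCommMonoid c.Quotient) with
      neg := neg
      zsmul := @zsmulRec c.Quotient ⟨0⟩ ⟨(· + ·)⟩ ⟨neg⟩ nsmulRec
      neg_add_cancel := hneg }
  exact ⟨c.Quotient, G, c.mk', hc⟩

/-- The isomorphism classes of objects of a category. -/
def IsoClass (C : Type*) [Category C] : Type _ := Quotient (isIsomorphicSetoid C)

/-- The isomorphism class of an object. -/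
def IsoClass.mk {C : Type*} [Category C] (X : C) : IsoClass C :=
  Quotient.mk (isIsomorphicSetoid C) X

theorem IsoClass.mk_eq_iff {C : Type*} [Category C] {X Y : C} :
    IsoClass.mk X = IsoClass.mk Y ↔ Nonempty (X ≅ Y) :=
  Quotient.eq (r := isIsomorphicSetoid C)

/-- Addition of isomorphism classes is induced by the direct sum. -/
noncomputable instance IsoClass.instAdd {C : Type*} [Category C] [Preadditive C]
    [HasBinaryBiproducts C] : Add (IsoClass C) where
  add := Quotient.map₂ (fun X Y => X ⊞ Y) fun _ _ ⟨e₁⟩ _ _ ⟨e₂⟩ => ⟨biprod.mapIso e₁ e₂⟩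

/-- The isomorphism class of the zero objects. -/
noncomputable instance IsoClass.instZero {C : Type*} [Category C] [HasZeroObject C] :
    Zero (IsoClass C) where
  zero := IsoClass.mk 0

/-- Direct sum makes the isomorphism classes of objects a commutative monoid. -/
noncomputable instance IsoClass.instAddCommMonoid {C : Type*} [Category C] [Preadditive C]
    [HasZeroObject C] [HasBinaryBiproducts C] : AddCommMonoid (IsoClass C) where
  add_assoc := by
    rintro ⟨X⟩ ⟨Y⟩ ⟨Z⟩
    exact IsoClass.mk_eq_iff.2 ⟨biprod.associator X Y Z⟩
  zero_add := by
    rintro ⟨X⟩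
    exact IsoClass.mk_eq_iff.2 ⟨(isoZeroBiprod (isZero_zero C)).symm⟩
  add_zero := by
    rintro ⟨X⟩
    exact IsoClass.mk_eq_iff.2 ⟨(isoBiprodZero (isZero_zero C)).symm⟩
  add_comm := by
    rintro ⟨X⟩ ⟨Y⟩
    exact IsoClass.mk_eq_iff.2 ⟨biprod.braiding X Y⟩
  nsmul := nsmulRec

theorem IsoClass.mk_biprod {C : Type*} [Category C] [Preadditive C]
    [HasBinaryBiproducts C] (X Y : C) :
    IsoClass.mk (X ⊞ Y) = IsoClass.mk X + IsoClass.mk Y := rfl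

theorem IsoClass.mk_zero {C : Type*} [Category C] [HasZeroObject C] {X : C} (hX : IsZero X) :
    IsoClass.mk X = 0 :=
  IsoClass.mk_eq_iff.2 ⟨hX.isoZero⟩

theorem IsoClass.mk_pi {C : Type*} [Category C] [Preadditive C]
    [HasBinaryBiproducts C] (f : WalkingPair → C) [HasProduct f] :
    IsoClass.mk (∏ᶜ f) = IsoClass.mk (f .left) + IsoClass.mk (f .right) :=
  IsoClass.mk_eq_iff.2 ⟨HasLimit.isoOfNatIso (diagramIsoPair (Discrete.functor f)) ≪≫
    (biprod.isoProd _ _).symm⟩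

theorem IsDirectSumOf.mk_eq {X Y Z : B} (h : IsDirectSumOf Y X Z) :
    IsoClass.mk Y = IsoClass.mk X + IsoClass.mk Z := by
  obtain ⟨i, j, p, q, hip, hjq, hiq, hjp, hY⟩ := h
  exact IsoClass.mk_eq_iff.2 ⟨⟨biprod.lift p q, biprod.desc i j, by simp [hY], by
    ext <;> simp [hip, hjq, hiq, hjp]⟩⟩

theorem exists_distinguished_mk_eq_add {T₁ T₂ : Triangle B} (h₁ : T₁ ∈ distTriang B)
    (h₂ : T₂ ∈ distTriang B) : ∃ T ∈ distTriang B,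
      IsoClass.mk T.obj₁ = IsoClass.mk T₁.obj₁ + IsoClass.mk T₂.obj₁ ∧
      IsoClass.mk T.obj₂ = IsoClass.mk T₁.obj₂ + IsoClass.mk T₂.obj₂ ∧
      IsoClass.mk T.obj₃ = IsoClass.mk T₁.obj₃ + IsoClass.mk T₂.obj₃ := by
  let T : WalkingPair → Triangle B := fun j => WalkingPair.casesOn j T₁ T₂
  refine ⟨productTriangle T, productTriangle_distinguished T ?_,
    IsoClass.mk_pi fun j => (T j).obj₁, IsoClass.mk_pi fun j => (T j).obj₂,
    IsoClass.mk_pi fun j => (T j).obj₃⟩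
  rintro (_ | _)
  exacts [h₁, h₂]

namespace IsTriangulatedSub

variable {S : Set B}

theorem mem_iff_of_mk_eq (hS : IsTriangulatedSub S) {X Y : B}
    (h : IsoClass.mk X = IsoClass.mk Y) : X ∈ S ↔ Y ∈ S := by
  obtain ⟨e⟩ := IsoClass.mk_eq_iff.1 h
  exact ⟨hS.iso e, hS.iso e.symm⟩

theorem mem_obj₂ (hS : IsTriangulatedSub S) {T : Triangle B} (hT : T ∈ distTriang B)
    (h₁ : T.obj₁ ∈ S) (h₃ : T.obj₃ ∈ S) : T.obj₂ ∈ S :=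
  hS.cone _ (inv_rot_of_distTriang _ hT) (hS.shift _ _ h₃) h₁

theorem zero_mem (hS : IsTriangulatedSub S) (hne : S.Nonempty) : (0 : B) ∈ S := by
  obtain ⟨X, hX⟩ := hne
  exact hS.cone _ (contractible_distinguished X) hX hX

/-- The isomorphism classes of the objects of a nonempty triangulated subcategory. -/
def isoClasses (hS : IsTriangulatedSub S) (hne : S.Nonempty) : AddSubmonoid (IsoClass B) where
  carrier := {a | ∃ X ∈ S, IsoClass.mk X = a}
  zero_mem' := ⟨0, hS.zero_mem hne, IsoClass.mk_zero (isZero_zero B)⟩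
  add_mem' := by
    rintro _ _ ⟨X, hX, rfl⟩ ⟨Y, hY, rfl⟩
    exact ⟨X ⊞ Y, hS.mem_obj₂ (binaryBiproductTriangle_distinguished X Y) hX hY, rfl⟩

theorem mk_mem_isoClasses (hS : IsTriangulatedSub S) (hne : S.Nonempty) {X : B} :
    IsoClass.mk X ∈ hS.isoClasses hne ↔ X ∈ S :=
  ⟨fun ⟨_, hY, h⟩ => (hS.mem_iff_of_mk_eq h).1 hY, fun hX => ⟨X, hX, rfl⟩⟩

theorem isoClasses_cancel (hS : IsTriangulatedSub S) (hne : S.Nonempty) (a b : IsoClass B)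
    (ha : a ∈ hS.isoClasses hne) (hab : a + b ∈ hS.isoClasses hne) :
    b ∈ hS.isoClasses hne := by
  obtain ⟨X⟩ := a
  obtain ⟨Y⟩ := b
  exact (hS.mk_mem_isoClasses hne (X := Y)).2
    (hS.cone _ (binaryBiproductTriangle_distinguished X Y)
      ((hS.mk_mem_isoClasses hne (X := X)).1 ha)
      ((hS.mk_mem_isoClasses hne (X := X ⊞ Y)).1 hab))

/-- The objects admitting a complement in a triangulated subcategory form a triangulated
subcategory. -/
theorem setOf_exists_biprod_mem (hS : IsTriangulatedSub S) :
    IsTriangulatedSub {X : B | ∃ Y, (X ⊞ Y) ∈ S} where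
  iso := fun _ _ e ⟨Z, hZ⟩ => ⟨Z, hS.iso (biprod.mapIso e (Iso.refl Z)) hZ⟩
  shift := by
    rintro X n ⟨Y, hY⟩
    have := preservesBinaryBiproducts_of_preservesBiproducts (shiftFunctor B n)
    exact ⟨Y⟦n⟧, hS.iso ((shiftFunctor B n).mapBiprod X Y) (hS.shift _ n hY)⟩
  cone := by
    rintro T hT ⟨X, hX⟩ ⟨Y, hY⟩
    obtain ⟨T', hT', h₁', h₂', h₃'⟩ :=
      exists_distinguished_mk_eq_add (contractible_distinguished₂ X) (contractible_distinguished₁ Y)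
    obtain ⟨U, hU, h₁, h₂, h₃⟩ := exists_distinguished_mk_eq_add hT hT'
    have h0 : IsoClass.mk (0 : B) = 0 := IsoClass.mk_zero (isZero_zero B)
    change _ = IsoClass.mk X + IsoClass.mk (0 : B) at h₁'
    change _ = IsoClass.mk (0 : B) + IsoClass.mk Y at h₂'
    change _ = IsoClass.mk (X⟦(1 : ℤ)⟧) + IsoClass.mk Y at h₃'
    refine ⟨X⟦(1 : ℤ)⟧ ⊞ Y, (hS.mem_iff_of_mk_eq ?_).1 (hS.cone U hU
      ((hS.mem_iff_of_mk_eq ?_).1 hX) ((hS.mem_iff_of_mk_eq ?_).1 hY))⟩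
    · rw [h₃, h₃', IsoClass.mk_biprod, IsoClass.mk_biprod]
    · rw [h₁, h₁', h0, add_zero, IsoClass.mk_biprod]
    · rw [h₂, h₂', h0, zero_add, IsoClass.mk_biprod]

theorem exists_biprod_mem_of_mem_thickEnvelope (hS : IsTriangulatedSub S)
    {X : B} (hX : X ∈ ThickEnvelope S) : ∃ Y, (X ⊞ Y) ∈ S := by
  refine hX {X : B | ∃ Y, (X ⊞ Y) ∈ S} ⟨fun Z hZ => ⟨0, ?_⟩, hS.setOf_exists_biprod_mem, ?_⟩
  · exact hS.iso (isoBiprodZero (isZero_zero B)) hZ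
  · rintro Z W ⟨Z', hW⟩ ⟨V, hV⟩
    refine ⟨Z' ⊞ V, (hS.mem_iff_of_mk_eq ?_).1 hV⟩
    simp only [IsoClass.mk_biprod, hW.mk_eq, add_assoc]

end IsTriangulatedSub

theorem nonempty_of_nonempty_thickEnvelope {S : Set B} (h : (ThickEnvelope S).Nonempty) :
    S.Nonempty := by
  rw [Set.nonempty_iff_ne_empty]
  rintro rfl
  obtain ⟨X, hX⟩ := h
  exact hX ∅ ⟨subset_rfl, ⟨fun _ _ _ h => h, fun _ _ h => h.elim, fun _ _ h _ => h.elim⟩,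
    fun _ _ _ h => h⟩

/-- A function on isomorphism classes that is additive on distinguished triangles induces a
homomorphism out of `K₀(B)`. -/
theorem K0B.exists_hom {G : Type*} [AddCommGroup G] (f : IsoClass B → G)
    (hf : ∀ T ∈ distTriang B,
      f (IsoClass.mk T.obj₂) = f (IsoClass.mk T.obj₁) + f (IsoClass.mk T.obj₃)) :
    ∃ φ : K0B (B := B) →+ G, ∀ X : B, φ (clsB X) = f (IsoClass.mk X) := by
  obtain ⟨g, hg⟩ : ∃ g : FGroup B →+ G, ∀ X : B, g (fo X) = f (IsoClass.mk X) :=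
    ⟨FreeAbelianGroup.lift f, fun X => FreeAbelianGroup.lift_apply_of f _⟩
  refine ⟨QuotientAddGroup.lift K0RelB g ?_, hg⟩
  refine (AddSubgroup.closure_le _).2 ?_
  rintro _ ⟨T, hT, rfl⟩
  simp only [SetLike.mem_coe, AddMonoidHom.mem_ker, map_sub]
  rw [hg, hg, hg, hf T hT]
  abel

theorem mem_iff_k0_class_mem [IsTriangulated B] (S : Set B)
    (hS : IsTriangulatedSub S)
    (henv : ∀ X : B, X ∈ ThickEnvelope S) :
    ∀ X : B, X ∈ S ↔ clsB X ∈ K0AImage S := by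
  have hne : S.Nonempty := nonempty_of_nonempty_thickEnvelope ⟨0, henv 0⟩
  have hcompl := fun X : B => hS.exists_biprod_mem_of_mem_thickEnvelope (henv X)
  obtain ⟨G, _, f, hf⟩ := (hS.isoClasses hne).exists_addMonoidHom_eq_zero_iff
    (hS.isoClasses_cancel hne) (by
      rintro ⟨X⟩
      obtain ⟨Y, hY⟩ := hcompl X
      exact ⟨IsoClass.mk Y, (hS.mk_mem_isoClasses hne (X := X ⊞ Y)).2 hY⟩)
  have hfS : ∀ X : B, f (IsoClass.mk X) = 0 ↔ X ∈ S := fun X =>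
    (hf _).trans (hS.mk_mem_isoClasses hne)
  obtain ⟨φ, hφ⟩ := K0B.exists_hom f (fun T hT => by
    obtain ⟨X, hX⟩ := hcompl T.obj₁
    obtain ⟨Z, hZ⟩ := hcompl T.obj₃
    obtain ⟨T', hT', h₁', h₂', h₃'⟩ :=
      exists_distinguished_mk_eq_add hT (binaryBiproductTriangle_distinguished X Z)
    have h₁ : T'.obj₁ ∈ S := (hS.mem_iff_of_mk_eq h₁').2 hX
    have h₃ : T'.obj₃ ∈ S := (hS.mem_iff_of_mk_eq h₃').2 hZ
    have h₂ := (hfS _).2 (hS.mem_obj₂ hT' h₁ h₃)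
    rw [← hfS, IsoClass.mk_biprod, map_add] at hX hZ
    rw [h₂'] at h₂
    change f (IsoClass.mk T.obj₂ + IsoClass.mk (X ⊞ Z)) = 0 at h₂
    rw [IsoClass.mk_biprod, map_add, map_add] at h₂
    rw [eq_neg_of_add_eq_zero_left h₂, eq_neg_of_add_eq_zero_left hX,
      eq_neg_of_add_eq_zero_left hZ, neg_add])
  refine fun X => ⟨fun hX => AddSubgroup.subset_closure ⟨X, hX, rfl⟩, fun hX => ?_⟩
  have hker : K0AImage S ≤ φ.ker := by
    refine (AddSubgroup.closure_le _).2 ?_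
    rintro _ ⟨W, hW, rfl⟩
    exact (hφ W).trans ((hfS W).2 hW)
  exact (hfS X).1 ((hφ X).symm.trans (hker hX))
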